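/- arXiv:1001.4888 — 2 statements merged into one kernel-verified Lean document; each statement's English description precedes it below -/
import Mathlib

section
/- Let T = 2^{<ω}, let I_0 and I_1 be the ideals on T generated by {a_x^0 : x ∈ 2^ω} and {a_x^1 : x ∈ 2^ω} respectively, and let I_2 = J be the ideal on T generated by the antichains of T. The 3-gap {I_0, I_1, I_2} is neither a jigsaw nor a clover; in particular, it is not a {0,1}-jigsaw and it is not a {1,2}-clover. -/
/-- An ideal on a countable set `E`: contains all finite sets, closed under
finite unions and subsets. -/
def IsIdeal {E : Type*} (I : Set (Set E)) : Prop :=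
  (∀ s : Set E, s.Finite → s ∈ I) ∧
  (∀ a ∈ I, ∀ b ∈ I, a ∪ b ∈ I) ∧
  (∀ a ∈ I, ∀ b : Set E, b ⊆ a → b ∈ I)

/-- Two families of sets are orthogonal (mod finite). -/
def Orth {E : Type*} (I J : Set (Set E)) : Prop := ∀ a ∈ I, ∀ b ∈ J, (a ∩ b).Finite

/-- `I ≤ c` mod finite: every member of `I` is almost contained in `c`. -/
def IdealLe {E : Type*} (I : Set (Set E)) (c : Set E) : Prop := ∀ x ∈ I, (x \ c).Finite

/-- `b ∈ I^⊥`: `b` has finite intersection with every member of `I`. -/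
def InPerp {E : Type*} (b : Set E) (I : Set (Set E)) : Prop := ∀ x ∈ I, (b ∩ x).Finite

/-- The restriction `I|_a = {x ∈ I : x \ a finite}`. -/
def Restrict {E : Type*} (I : Set (Set E)) (a : Set E) : Set (Set E) :=
  {x ∈ I | (x \ a).Finite}

/-- The family `{I_i : i ∈ A}` is a multiple gap: pairwise orthogonal and for any
sets `c i` with `I i ≤ c i` (for `i ∈ A`), the intersection `⋂ i ∈ A, c i` is infinite. -/
def MultiGap {E : Type*} {n : ℕ} (A : Set (Fin n)) (I : Fin n → Set (Set E)) : Prop :=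
  (∀ i ∈ A, ∀ j ∈ A, i ≠ j → Orth (I i) (I j)) ∧
  ∀ c : Fin n → Set E, (∀ i ∈ A, IdealLe (I i) (c i)) → (⋂ i ∈ A, c i).Infinite

/-- An `n`-gap: a multiple gap indexed by all of `n`. -/
def IsGap {E : Type*} {n : ℕ} (I : Fin n → Set (Set E)) : Prop := MultiGap Set.univ I

/-- `{I_i : i < n}` is a `B`-jigsaw. -/
def IsBJigsaw {E : Type*} {n : ℕ} (I : Fin n → Set (Set E)) (B : Set (Fin n)) : Prop :=
  ∀ A : Set (Fin n), B ⊆ A → ∀ a : Set E,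
    MultiGap A (fun i => Restrict (I i) a) →
    ∃ b : Set E, b ⊆ a ∧ MultiGap B (fun i => Restrict (I i) b) ∧
      ∀ i ∈ A \ B, InPerp b (I i)

/-- `{I_i : i < n}` is a `B`-clover. -/
def IsBClover {E : Type*} {n : ℕ} (I : Fin n → Set (Set E)) (B : Set (Fin n)) : Prop :=
  ¬ ∃ b : Set E, MultiGap B (fun i => Restrict (I i) b) ∧
      ∀ i ∈ Set.univ \ B, InPerp b (I i)

/-- Weak countable separation. -/
def WeaklyCS {E : Type*} {n : ℕ} (I : Fin n → Set (Set E)) : Prop :=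
  ∃ c : Fin n → ℕ → Set E,
    (∀ k, (⋂ i, c i k).Finite) ∧
    ∀ x : Fin n → Set E, (∀ i, x i ∈ I i) → ∃ k, ∀ i, (x i \ c i k).Finite

/-- Strong countable separation. -/
def StronglyCS {E : Type*} {n : ℕ} (I : Fin n → Set (Set E)) : Prop :=
  ∃ c : Fin n → ℕ → Set E,
    (∀ k, ∀ i j : Fin n, i ≠ j → (c i k ∩ c j k).Finite) ∧
    ∀ x : Fin n → Set E, (∀ i, x i ∈ I i) → ∃ k, ∀ i, (x i \ c i k).Finite

/-- The ideal generated by a family `G` of subsets of `E`: all sets almost covered by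
finitely many members of `G`. -/
def GenIdeal {E : Type*} (G : Set (Set E)) : Set (Set E) :=
  {b | ∃ F : Finset (Set E), ↑F ⊆ G ∧ (b \ ⋃₀ ↑F).Finite}

/-- `s` is an initial segment of the branch `x ∈ n^ω`. -/
def IsInitSeg {n : ℕ} (s : List (Fin n)) (x : ℕ → Fin n) : Prop :=
  ∀ k : ℕ, ∀ h : k < s.length, s.get ⟨k, h⟩ = x k

/-- `a_x^i = {s ∈ n^{<ω} : s⌢i is an initial segment of x}`. -/
def sideSet {n : ℕ} (x : ℕ → Fin n) (i : Fin n) : Set (List (Fin n)) :=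
  {s | IsInitSeg (s ++ [i]) x}

/-- The ideal `J_i` on the `n`-ary tree generated by the sets `a_x^i`, `x ∈ n^ω`. -/
def treeIdeal (n : ℕ) (i : Fin n) : Set (Set (List (Fin n))) :=
  GenIdeal {a | ∃ x : ℕ → Fin n, a = sideSet x i}

/-- The three ideals on the dyadic tree: `I_0`, `I_1` generated by the sets `a_x^0`, `a_x^1`
for branches `x ∈ 2^ω`, and `I_2 = J` generated by the antichains of `T = 2^{<ω}`
(with respect to the end-extension order, i.e. the prefix order). -/
def dyadicIdeal : Fin 3 → Set (Set (List (Fin 2)))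
  | 0 => treeIdeal 2 0
  | 1 => treeIdeal 2 1
  | 2 => GenIdeal {a : Set (List (Fin 2)) | IsAntichain (· <+: ·) a}

theorem inPerp_genIdeal {E : Type*} {G : Set (Set E)} {b : Set E}
    (h : ∀ g ∈ G, (b ∩ g).Finite) : InPerp b (GenIdeal G) := by
  rintro x ⟨F, hF, hx⟩
  refine (hx.union (F.finite_toSet.biUnion fun g hg => h g (hF hg))).subset ?_
  rintro t ⟨htb, htx⟩
  by_cases ht : t ∈ ⋃₀ (F : Set (Set E))
  · obtain ⟨g, hg, htg⟩ := ht
    exact Or.inr (Set.mem_biUnion hg ⟨htb, htg⟩)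
  · exact Or.inl ⟨htx, ht⟩

theorem orth_genIdeal {E : Type*} {G H : Set (Set E)}
    (h : ∀ g ∈ G, ∀ k ∈ H, (g ∩ k).Finite) : Orth (GenIdeal G) (GenIdeal H) := by
  intro a ha
  refine inPerp_genIdeal fun k hk => ?_
  rw [Set.inter_comm]
  refine inPerp_genIdeal (fun g hg => ?_) a ha
  rw [Set.inter_comm]
  exact h g hg k hk

theorem Orth.symm {E : Type*} {I J : Set (Set E)} (h : Orth I J) : Orth J I := by
  intro a ha b hb
  rw [Set.inter_comm]
  exact h b hb a ha

theorem mem_genIdeal_of_subset {E : Type*} {G : Set (Set E)} {a g : Set E}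
    (hg : g ∈ G) (ha : a ⊆ g) : a ∈ GenIdeal G := by
  refine ⟨{g}, by simpa using hg, ?_⟩
  refine Set.finite_empty.subset fun t ht => ht.2 ?_
  simpa using ha ht.1

theorem prefix_of_isInitSeg {n : ℕ} {s t : List (Fin n)} {x : ℕ → Fin n}
    (hs : IsInitSeg s x) (ht : IsInitSeg t x) (h : s.length ≤ t.length) : s <+: t := by
  rw [List.prefix_iff_getElem]
  refine ⟨h, fun k hk => ?_⟩
  have h1 := hs k hk
  have h2 := ht k (hk.trans_le h)
  simp only [List.get_eq_getElem] at h1 h2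
  rw [h1, h2]

theorem prefix_of_mem_sideSet {n : ℕ} {s t : List (Fin n)} {x : ℕ → Fin n} {i j : Fin n}
    (hs : s ∈ sideSet x i) (ht : t ∈ sideSet x j) (h : s.length < t.length) :
    s ++ [i] <+: t := by
  have h1 : s ++ [i] <+: t ++ [j] := prefix_of_isInitSeg hs ht (by simp; omega)
  exact List.prefix_of_prefix_length_le h1 (List.prefix_append t [j]) (by simp; omega)

theorem sideSet_eq_of_length {n : ℕ} {s t : List (Fin n)} {x : ℕ → Fin n} {i j : Fin n}
    (hs : s ∈ sideSet x i) (ht : t ∈ sideSet x j) (h : s.length = t.length) : s = t := by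
  have h1 : s ++ [i] <+: t ++ [j] := prefix_of_isInitSeg hs ht (by simp; omega)
  have h2 := h1.eq_of_length (by simp; omega)
  exact (List.append_inj h2 h).1

theorem append_singleton_prefix_inj {α : Type*} {s t : List α} {i j : α}
    (hi : s ++ [i] <+: t) (hj : s ++ [j] <+: t) : i = j := by
  have h := (List.prefix_of_prefix_length_le hi hj (by simp)).eq_of_length (by simp)
  simpa using h

theorem sideSet_inter_finite {n : ℕ} (x y : ℕ → Fin n) {i j : Fin n} (hij : i ≠ j) :
    (sideSet x i ∩ sideSet y j).Finite := by
  refine Set.Subsingleton.finite ?_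
  rintro s ⟨hs0, hs1⟩ t ⟨ht0, ht1⟩
  rcases lt_trichotomy s.length t.length with h | h | h
  · exact absurd (append_singleton_prefix_inj (prefix_of_mem_sideSet hs0 ht0 h)
      (prefix_of_mem_sideSet hs1 ht1 h)) hij
  · exact sideSet_eq_of_length hs0 ht0 h
  · exact absurd (append_singleton_prefix_inj (prefix_of_mem_sideSet ht0 hs0 h)
      (prefix_of_mem_sideSet ht1 hs1 h)) hij

theorem sideSet_inter_antichain_finite {n : ℕ} (x : ℕ → Fin n) (i : Fin n)
    {a : Set (List (Fin n))} (ha : IsAntichain (· <+: ·) a) : (sideSet x i ∩ a).Finite := by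
  refine Set.Subsingleton.finite ?_
  rintro s ⟨hs, hsa⟩ t ⟨ht, hta⟩
  rcases lt_trichotomy s.length t.length with h | h | h
  · exact ha.eq hsa hta ((List.prefix_append _ _).trans (prefix_of_mem_sideSet hs ht h))
  · exact sideSet_eq_of_length hs ht h
  · exact (ha.eq hta hsa ((List.prefix_append _ _).trans (prefix_of_mem_sideSet ht hs h))).symm

theorem dyadicIdeal_orth {i j : Fin 3} (hij : i ≠ j) :
    Orth (dyadicIdeal i) (dyadicIdeal j) := by
  have h01 : Orth (dyadicIdeal 0) (dyadicIdeal 1) := by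
    refine orth_genIdeal ?_
    rintro _ ⟨x, rfl⟩ _ ⟨y, rfl⟩
    exact sideSet_inter_finite x y (by decide)
  have h02 : Orth (dyadicIdeal 0) (dyadicIdeal 2) := by
    refine orth_genIdeal ?_
    rintro _ ⟨x, rfl⟩ a ha
    exact sideSet_inter_antichain_finite x 0 ha
  have h12 : Orth (dyadicIdeal 1) (dyadicIdeal 2) := by
    refine orth_genIdeal ?_
    rintro _ ⟨x, rfl⟩ a ha
    exact sideSet_inter_antichain_finite x 1 ha
  fin_cases i <;> fin_cases j <;>
    first
    | exact absurd rfl hij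
    | exact h01
    | exact h02
    | exact h12
    | exact h01.symm
    | exact h02.symm
    | exact h12.symm

theorem restrict_dyadicIdeal_orth (a : Set (List (Fin 2))) {i j : Fin 3} (hij : i ≠ j) :
    Orth (Restrict (dyadicIdeal i) a) (Restrict (dyadicIdeal j) a) :=
  fun x hx y hy => dyadicIdeal_orth hij x hx.1 y hy.1

theorem antichain_mem_dyadicIdeal {a : Set (List (Fin 2))} (ha : IsAntichain (· <+: ·) a) :
    a ∈ dyadicIdeal 2 :=
  mem_genIdeal_of_subset (G := {a | IsAntichain (· <+: ·) a}) ha subset_rfl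

theorem subset_sideSet_zero_mem {x : ℕ → Fin 2} {a : Set (List (Fin 2))}
    (ha : a ⊆ sideSet x 0) : a ∈ dyadicIdeal 0 :=
  mem_genIdeal_of_subset (G := {a | ∃ x : ℕ → Fin 2, a = sideSet x 0}) ⟨x, rfl⟩ ha

theorem subset_sideSet_one_mem {x : ℕ → Fin 2} {a : Set (List (Fin 2))}
    (ha : a ⊆ sideSet x 1) : a ∈ dyadicIdeal 1 :=
  mem_genIdeal_of_subset (G := {a | ∃ x : ℕ → Fin 2, a = sideSet x 1}) ⟨x, rfl⟩ ha

/-- Iterating a rule for choosing the next letter yields a branch through the starting node. -/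
theorem exists_branch {n : ℕ} [NeZero n] (s : List (Fin n)) (P : List (Fin n) → Fin n) :
    ∃ (x : ℕ → Fin n) (u : ℕ → List (Fin n)), Function.Injective u ∧
      ∀ k, s <+: u k ∧ u k ∈ sideSet x (P (u k)) := by
  let u : ℕ → List (Fin n) := fun k => (fun t => t ++ [P t])^[k] s
  have hu : ∀ k, u (k + 1) = u k ++ [P (u k)] := fun k =>
    Function.iterate_succ_apply' _ _ _
  have hlen : ∀ k, (u k).length = s.length + k := by
    intro k
    induction k with
    | zero => rfl
    | succ k ih => rw [hu, List.length_append, ih]; simp; omega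
  have hmono : ∀ k m, k ≤ m → u k <+: u m := by
    intro k m h
    induction m, h using Nat.le_induction with
    | base => exact List.prefix_rfl
    | succ m _ ih => exact ih.trans (by rw [hu]; exact List.prefix_append _ _)
  let x : ℕ → Fin n := fun k => (u (k + 1)).getD k 0
  refine ⟨x, u, fun k m h => ?_, fun k => ⟨hmono 0 k (Nat.zero_le k), ?_⟩⟩
  · have := congrArg List.length h
    rw [hlen, hlen] at this
    omega
  · change IsInitSeg (u k ++ [P (u k)]) x
    rw [← hu]
    intro j hj
    have hj' : j < (u (j + 1)).length := by rw [hlen]; omega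
    have hx : x j = (u (j + 1))[j] := by simp [x, hj']
    rw [hx, List.get_eq_getElem]
    rcases le_total (k + 1) (j + 1) with h | h
    · exact (hmono _ _ h).getElem hj
    · exact ((hmono _ _ h).getElem hj').symm

/-- If `c₀` and `c₁` almost contain `I_0` and `I_1`, then `c₀ ∩ c₁` is dense in the tree. -/
theorem exists_extension_mem_inter {c₀ c₁ : Set (List (Fin 2))}
    (h₀ : ∀ x, (sideSet x 0 \ c₀).Finite) (h₁ : ∀ x, (sideSet x 1 \ c₁).Finite)
    (s : List (Fin 2)) : ∃ t, s <+: t ∧ t ∈ c₀ ∧ t ∈ c₁ := by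
  classical
  by_contra! hcon
  obtain ⟨x, u, hinj, hu⟩ := exists_branch s (fun t => if t ∈ c₀ then 1 else 0)
  refine (Set.infinite_range_of_injective hinj) (((h₀ x).union (h₁ x)).subset ?_)
  rintro _ ⟨k, rfl⟩
  obtain ⟨hsk, hk⟩ := hu k
  by_cases hc : u k ∈ c₀
  · rw [if_pos hc] at hk
    exact Or.inr ⟨hk, hcon _ hsk hc⟩
  · rw [if_neg hc] at hk
    exact Or.inl ⟨hk, hc⟩

theorem eq_of_comb_prefix_same {m n : ℕ} {t : List (Fin 2)}
    (hm : List.replicate m 1 ++ [0] <+: t) (hn : List.replicate n 1 ++ [0] <+: t) : m = n := by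
  wlog h : m < n generalizing m n
  · rcases (not_lt.1 h).lt_or_eq with h | h
    · exact (this hn hm h).symm
    · exact h.symm
  have h1 : List.replicate m (1 : Fin 2) ++ [1] <+: List.replicate n 1 := by
    rw [← List.replicate_succ', List.prefix_replicate_iff]
    simpa using h
  have := append_singleton_prefix_inj hm ((h1.trans (List.prefix_append _ [0])).trans hn)
  exact absurd this (by decide)

/-- Extensions of the pairwise incomparable nodes `1^n 0` form an infinite antichain. -/
theorem comb_antichain {t : ℕ → List (Fin 2)}
    (ht : ∀ n, List.replicate n 1 ++ [0] <+: t n) :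
    IsAntichain (· <+: ·) (Set.range t) ∧ (Set.range t).Infinite := by
  constructor
  · rintro _ ⟨m, rfl⟩ _ ⟨n, rfl⟩ hne hmn
    exact hne (congrArg t (eq_of_comb_prefix_same ((ht m).trans hmn) (ht n)))
  · refine Set.infinite_range_of_injective fun m n h => ?_
    exact eq_of_comb_prefix_same (ht m) (h ▸ ht n)

theorem multiGap_dyadicIdeal :
    MultiGap Set.univ (fun i => Restrict (dyadicIdeal i) Set.univ) := by
  refine ⟨fun i _ j _ hij => restrict_dyadicIdeal_orth _ hij, fun c hc => ?_⟩
  have h₀ : ∀ x, (sideSet x 0 \ c 0).Finite := fun x =>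
    hc 0 trivial _ ⟨subset_sideSet_zero_mem subset_rfl, by simp⟩
  have h₁ : ∀ x, (sideSet x 1 \ c 1).Finite := fun x =>
    hc 1 trivial _ ⟨subset_sideSet_one_mem subset_rfl, by simp⟩
  choose t ht ht0 ht1 using fun n : ℕ =>
    exists_extension_mem_inter h₀ h₁ (List.replicate n 1 ++ [0])
  obtain ⟨hanti, hinf⟩ := comb_antichain ht
  have h₂ : (Set.range t \ c 2).Finite :=
    hc 2 trivial _ ⟨antichain_mem_dyadicIdeal hanti, by simp⟩
  refine (hinf.sdiff h₂).mono ?_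
  rintro _ ⟨⟨n, rfl⟩, hn⟩
  have h2 : t n ∈ c 2 := by
    by_contra h
    exact hn ⟨⟨n, rfl⟩, h⟩
  simp only [Set.mem_univ, Set.iInter_true, Set.mem_iInter]
  intro i
  fin_cases i
  · exact ht0 n
  · exact ht1 n
  · exact h2

theorem exists_chain_or_antichain {D : Set (List (Fin 2))} (hD : D.Infinite) :
    ∃ f : ℕ → List (Fin 2), (∀ n, f n ∈ D) ∧ (∀ m n, m < n → (f m).length < (f n).length) ∧
      ((∀ m n, m < n → f m <+: f n) ∨ IsAntichain (· <+: ·) (Set.range f)) := by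
  have hinf : {k | ∃ s ∈ D, s.length = k}.Infinite := by
    refine Set.infinite_of_forall_exists_gt fun N => ?_
    by_contra! h
    refine hD ((List.finite_length_le (Fin 2) N).subset fun s hs => ?_)
    exact h s.length ⟨s, hs, rfl⟩
  choose f hfD hf using fun n : ℕ => Nat.nth_mem_of_infinite hinf n
  have hlt : ∀ m n, m < n → (f m).length < (f n).length := fun m n h => by
    rw [hf, hf]
    exact Nat.nth_strictMono hinf h
  have : IsTrans (List (Fin 2)) (· <+: ·) := ⟨fun _ _ _ h h' => h.trans h'⟩
  obtain ⟨g, hg⟩ := exists_increasing_or_nonincreasing_subseq (· <+: ·) f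
  refine ⟨fun n => f (g n), fun n => hfD _, fun m n h => hlt _ _ (g.strictMono h), ?_⟩
  refine hg.imp id fun hg => ?_
  rintro _ ⟨m, rfl⟩ _ ⟨n, rfl⟩ hne hmn
  rcases lt_trichotomy m n with h | rfl | h
  · exact hg m n h hmn
  · exact hne rfl
  · exact absurd hmn.length_le (hlt _ _ (g.strictMono h)).not_ge

/-- A set with no infinite antichain has only finitely many elements above which it is
infinite in both directions. -/
theorem finite_splitting {b : Set (List (Fin 2))} (hb : InPerp b (dyadicIdeal 2)) :
    {s ∈ b | ∀ i : Fin 2, {t ∈ b | s ++ [i] <+: t}.Infinite}.Finite := by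
  by_contra hD
  obtain ⟨f, hfD, hlen, hf | hf⟩ := exists_chain_or_antichain hD
  · have hturn : ∀ n, ∃ i, f n ++ [i] <+: f (n + 1) := by
      intro n
      obtain ⟨u, hu⟩ := hf n (n + 1) n.lt_succ_self
      cases u with
      | nil =>
        have := hlen n (n + 1) n.lt_succ_self
        simp [← hu] at this
      | cons i u => exact ⟨i, u, by simpa using hu⟩
    choose i hi using hturn
    have hoff : ∀ n, ∃ t ∈ b, f n ++ [i n + 1] <+: t := fun n =>
      ((hfD n).2 (i n + 1)).nonempty
    choose t htb ht using hoff
    have hne : ∀ n, i n + 1 ≠ i n := fun n => by generalize i n = j; revert j; decide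
    have hinc : ∀ m n r, m < n → t m <+: r → t n <+: r → False := by
      intro m n r hmn hm hn
      have h1 : f (m + 1) <+: f n := by
        rcases (Nat.succ_le_of_lt hmn).lt_or_eq with h | h
        · exact hf _ _ h
        · rw [← h]
      have h2 : f n <+: t n := (List.prefix_append _ _).trans (ht n)
      exact hne m (append_singleton_prefix_inj ((ht m).trans hm)
        ((hi m).trans (h1.trans (h2.trans hn))))
    have hinj : Function.Injective t := by
      intro m n h
      rcases lt_trichotomy m n with h' | h' | h'
      · exact (hinc m n (t n) h' (h ▸ List.prefix_rfl) List.prefix_rfl).elim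
      · exact h'
      · exact (hinc n m (t n) h' List.prefix_rfl (h ▸ List.prefix_rfl)).elim
    have hanti : IsAntichain (· <+: ·) (Set.range t) := by
      rintro _ ⟨m, rfl⟩ _ ⟨n, rfl⟩ hne hmn
      rcases lt_trichotomy m n with h' | rfl | h'
      · exact hinc m n _ h' hmn List.prefix_rfl
      · exact hne rfl
      · exact hinc n m _ h' List.prefix_rfl hmn
    refine Set.infinite_range_of_injective hinj
      ((hb _ (antichain_mem_dyadicIdeal hanti)).subset ?_)
    rintro _ ⟨n, rfl⟩
    exact ⟨htb n, n, rfl⟩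
  · have hinj : Function.Injective f := by
      intro m n h
      rcases lt_trichotomy m n with h' | h' | h'
      · exact absurd (hlen m n h') (by rw [h]; exact lt_irrefl _)
      · exact h'
      · exact absurd (hlen n m h') (by rw [h]; exact lt_irrefl _)
    refine Set.infinite_range_of_injective hinj
      ((hb _ (antichain_mem_dyadicIdeal hf)).subset ?_)
    rintro _ ⟨n, rfl⟩
    exact ⟨(hfD n).1, n, rfl⟩

theorem restrict_treeIdeal_le (b : Set (List (Fin 2))) (i : Fin 2) :
    IdealLe (Restrict (treeIdeal 2 i) b)
      {s ∈ b | {t ∈ b | s ++ [i] <+: t}.Infinite} := by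
  rintro x ⟨hx, hxb⟩
  set c := {s ∈ b | {t ∈ b | s ++ [i] <+: t}.Infinite}
  have key : ((x ∩ b) \ c ∩ x).Finite := by
    refine inPerp_genIdeal (G := {a | ∃ x : ℕ → Fin 2, a = sideSet x i}) ?_ x hx
    rintro _ ⟨y, rfl⟩
    by_contra hinf
    obtain ⟨s, ⟨⟨_, hsb⟩, hsc⟩, hs⟩ := Set.Infinite.nonempty hinf
    refine hsc ⟨hsb, ?_⟩
    refine (Set.Infinite.sdiff hinf (List.finite_length_le (Fin 2) s.length)).mono ?_
    rintro t ⟨⟨⟨⟨_, htb⟩, _⟩, ht⟩, hlt⟩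
    exact ⟨htb, prefix_of_mem_sideSet hs ht (not_le.1 hlt)⟩
  refine (hxb.union key).subset ?_
  rintro s ⟨hsx, hsc⟩
  by_cases hsb : s ∈ b
  · exact Or.inr ⟨⟨⟨hsx, hsb⟩, hsc⟩, hsx⟩
  · exact Or.inl ⟨hsx, hsb⟩

theorem not_isBJigsaw_dyadicIdeal : ¬ IsBJigsaw dyadicIdeal {0, 1} := by
  intro h
  obtain ⟨b, -, hgap, hperp⟩ := h Set.univ (Set.subset_univ _) Set.univ multiGap_dyadicIdeal
  have hb : InPerp b (dyadicIdeal 2) := hperp 2 ⟨trivial, by simp⟩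
  let c : Fin 2 → Set (List (Fin 2)) := fun i => {s ∈ b | {t ∈ b | s ++ [i] <+: t}.Infinite}
  refine hgap.2 ![c 0, c 1, ∅] ?_ ((finite_splitting hb).subset ?_)
  · rintro i (rfl | rfl)
    · exact restrict_treeIdeal_le b 0
    · exact restrict_treeIdeal_le b 1
  · intro s hs
    simp only [Set.mem_iInter] at hs
    have h0 : s ∈ c 0 := hs 0 (by simp)
    have h1 : s ∈ c 1 := hs 1 (by simp)
    refine ⟨h0.1, fun i => ?_⟩
    fin_cases i
    · exact h0.2
    · exact h1.2

theorem count_zero_comb (n m : ℕ) :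
    (List.replicate n (1 : Fin 2) ++ [0] ++ List.replicate m 1).count 0 = 1 := by
  simp [List.count_replicate]

theorem comb_mem_sideSet (n m : ℕ) :
    List.replicate n (1 : Fin 2) ++ [0] ++ List.replicate m 1 ∈
      sideSet (fun k => if k = n then 0 else 1) 1 := by
  change IsInitSeg _ _
  rw [List.append_assoc, ← List.replicate_succ']
  intro k hk
  simp only [List.get_eq_getElem]
  grind

theorem inPerp_count_zero : InPerp {s : List (Fin 2) | s.count 0 = 1} (dyadicIdeal 0) := by
  refine inPerp_genIdeal ?_
  rintro _ ⟨x, rfl⟩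
  refine Set.Subsingleton.finite ?_
  have hlt : ∀ s t : List (Fin 2), s.count 0 = 1 → t.count 0 = 1 → s ∈ sideSet x 0 →
      t ∈ sideSet x 0 → ¬ s.length < t.length := by
    intro s t hs ht hsx htx h
    have := (prefix_of_mem_sideSet hsx htx h).sublist.count_le 0
    simp [hs, ht] at this
  rintro s ⟨hs, hsx⟩ t ⟨ht, htx⟩
  exact sideSet_eq_of_length hsx htx
    (le_antisymm (not_lt.1 (hlt t s ht hs htx hsx)) (not_lt.1 (hlt s t hs ht hsx htx)))

theorem multiGap_count_zero :
    MultiGap {1, 2} (fun i => Restrict (dyadicIdeal i) {s : List (Fin 2) | s.count 0 = 1}) := by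
  refine ⟨fun i _ j _ hij => restrict_dyadicIdeal_orth _ hij, fun c hc => ?_⟩
  have hcol : ∀ n, ∃ m, List.replicate n (1 : Fin 2) ++ [0] ++ List.replicate m 1 ∈ c 1 := by
    intro n
    by_contra! h
    have hinj : Function.Injective
        fun m => List.replicate n (1 : Fin 2) ++ [0] ++ List.replicate m 1 := by
      intro m k hmk
      simpa using congrArg List.length hmk
    refine Set.infinite_range_of_injective hinj ((hc 1 (by simp) (Set.range fun m =>
      List.replicate n (1 : Fin 2) ++ [0] ++ List.replicate m 1) ⟨?_, ?_⟩).subset ?_)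
    · refine subset_sideSet_one_mem (x := fun k => if k = n then 0 else 1) ?_
      rintro _ ⟨m, rfl⟩
      exact comb_mem_sideSet n m
    · refine Set.finite_empty.subset ?_
      rintro _ ⟨⟨m, rfl⟩, hm⟩
      exact hm (count_zero_comb n m)
    · rintro _ ⟨m, rfl⟩
      exact ⟨⟨m, rfl⟩, h m⟩
  choose f hf using hcol
  obtain ⟨hanti, hinf⟩ := comb_antichain
    (t := fun n => List.replicate n (1 : Fin 2) ++ [0] ++ List.replicate (f n) 1)
    fun n => List.prefix_append _ _
  have h₂ := hc 2 (by simp) _ ⟨antichain_mem_dyadicIdeal hanti, by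
    refine Set.finite_empty.subset ?_
    rintro _ ⟨⟨n, rfl⟩, hn⟩
    exact hn (count_zero_comb n (f n))⟩
  refine (hinf.sdiff h₂).mono ?_
  rintro _ ⟨⟨n, rfl⟩, hn⟩
  simp only [Set.mem_iInter]
  rintro i (rfl | rfl)
  · exact hf n
  · by_contra h
    exact hn ⟨⟨n, rfl⟩, h⟩

theorem not_isBClover_dyadicIdeal : ¬ IsBClover dyadicIdeal {1, 2} := by
  refine not_not.2 ⟨_, multiGap_count_zero, fun i hi => ?_⟩
  fin_cases i
  · exact inPerp_count_zero
  · exact absurd (by simp) hi.2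
  · exact absurd (by simp) hi.2

/-- The 3-gap `{I_0, I_1, J}` on the dyadic tree is neither a jigsaw nor a clover;
in particular it is not a `{0,1}`-jigsaw and not a `{1,2}`-clover. -/
theorem dyadic_antichain_not_jigsaw_not_clover :
    ¬ IsBJigsaw dyadicIdeal {0, 1} ∧
    ¬ IsBClover dyadicIdeal {1, 2} ∧
    ¬ (∀ B : Set (Fin 3), B.Nonempty → B ≠ Set.univ → IsBJigsaw dyadicIdeal B) ∧
    ¬ (∀ B : Set (Fin 3), B.Nonempty → B ≠ Set.univ → IsBClover dyadicIdeal B) := by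
  refine ⟨not_isBJigsaw_dyadicIdeal, not_isBClover_dyadicIdeal, fun h => ?_, fun h => ?_⟩
  · refine not_isBJigsaw_dyadicIdeal (h _ ⟨0, by simp⟩ fun hu => ?_)
    have : (2 : Fin 3) ∈ ({0, 1} : Set (Fin 3)) := hu ▸ Set.mem_univ _
    simp at this
  · refine not_isBClover_dyadicIdeal (h _ ⟨1, by simp⟩ fun hu => ?_)
    have : (0 : Fin 3) ∈ ({1, 2} : Set (Fin 3)) := hu ▸ Set.mem_univ _
    simp at this
end

section
/- Let n ≥ 2, let λ be a regular uncountable cardinal, and let X ⊆ n^ω be a set of cardinality at least λ with property A(λ,n): for every Y ⊆ X with |Y| = λ there exist t ∈ n^{<ω} and elements y^0, …, y^{n-1} ∈ Y such that t⌢i is an initial segment of y^i for every i < n. Then the ideals {J_i^X : i < n} on T = n^{<ω} form an n-gap which is not weakly countably separated. -/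
/-- `X ⊆ n^ω` has property `A(λ,n)`: every subset of `X` of cardinality `λ` contains
branches splitting in all `n` directions at some node. -/
def PropertyA {n : ℕ} (lam : Cardinal) (X : Set (ℕ → Fin n)) : Prop :=
  ∀ Y : Set (ℕ → Fin n), Y ⊆ X → Cardinal.mk ↥Y = lam →
    ∃ t : List (Fin n), ∃ y : Fin n → (ℕ → Fin n),
      (∀ i, y i ∈ Y) ∧ ∀ i, IsInitSeg (t ++ [i]) (y i)

/-- The ideal `J_i^X` on the `n`-ary tree generated by the sets `a_x^i` with `x ∈ X`. -/
def treeIdealX {n : ℕ} (X : Set (ℕ → Fin n)) (i : Fin n) : Set (Set (List (Fin n))) :=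
  GenIdeal {a | ∃ x ∈ X, a = sideSet x i}

theorem IsInitSeg.append_singleton_iff {n : ℕ} {s : List (Fin n)} {i : Fin n} {x : ℕ → Fin n} :
    IsInitSeg (s ++ [i]) x ↔ IsInitSeg s x ∧ x s.length = i := by
  constructor
  · intro h
    refine ⟨fun k hk => ?_, ?_⟩
    · have := h k (by simp; omega)
      simpa [List.getElem_append_left hk] using this
    · have := h s.length (by simp)
      simpa using this.symm
  · rintro ⟨h, hx⟩ k hk
    rcases lt_or_ge k s.length with hlt | hge
    · simpa [List.getElem_append_left hlt] using h k hlt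
    · obtain rfl : k = s.length := by
        simp at hk
        omega
      simpa using hx.symm

/-- Two branches split in distinct directions at one node at most. -/
theorem sideSet_inter_subsingleton {n : ℕ} (x y : ℕ → Fin n) {i j : Fin n} (hij : i ≠ j) :
    (sideSet x i ∩ sideSet y j).Subsingleton := by
  have not_lt : ∀ s ∈ sideSet x i ∩ sideSet y j, ∀ t ∈ sideSet x i ∩ sideSet y j,
      ¬ s.length < t.length := by
    rintro s ⟨hsx, hsy⟩ t ⟨htx, hty⟩ hlt
    have hsx' := (IsInitSeg.append_singleton_iff.1 hsx).2
    have hsy' := (IsInitSeg.append_singleton_iff.1 hsy).2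
    have htx' := (IsInitSeg.append_singleton_iff.1 htx).1 _ hlt
    have hty' := (IsInitSeg.append_singleton_iff.1 hty).1 _ hlt
    exact hij (by rw [← hsx', ← hsy', ← htx', ← hty'])
  intro s hs t ht
  have hlen : s.length = t.length := by
    have h₁ := not_lt s hs t ht
    have h₂ := not_lt t ht s hs
    omega
  refine List.ext_getElem hlen fun k hks hkt => ?_
  exact ((IsInitSeg.append_singleton_iff.1 hs.1).1 k hks).trans
    ((IsInitSeg.append_singleton_iff.1 ht.1).1 k hkt).symm

theorem mem_genIdeal_of_mem {E : Type*} {G : Set (Set E)} {a : Set E} (ha : a ∈ G) :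
    a ∈ GenIdeal G :=
  ⟨{a}, by simpa using ha, by simp⟩

/-- Orthogonality passes from generators to the generated ideals. -/
theorem Orth.genIdeal {E : Type*} {G H : Set (Set E)} (h : Orth G H) :
    Orth (GenIdeal G) (GenIdeal H) := by
  rintro a ⟨F, hFG, hF⟩ b ⟨K, hKH, hK⟩
  have hFK : (⋃ u ∈ F, ⋃ v ∈ K, u ∩ v).Finite :=
    F.finite_toSet.biUnion fun u hu => K.finite_toSet.biUnion fun v hv => h u (hFG hu) v (hKH hv)
  refine ((hF.union hK).union hFK).subset ?_
  rintro s ⟨hsa, hsb⟩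
  by_cases hsF : s ∈ ⋃₀ (F : Set (Set E))
  · by_cases hsK : s ∈ ⋃₀ (K : Set (Set E))
    · obtain ⟨u, hu, hsu⟩ := hsF
      obtain ⟨v, hv, hsv⟩ := hsK
      exact Or.inr (Set.mem_biUnion hu (Set.mem_biUnion hv ⟨hsu, hsv⟩))
    · exact Or.inl (Or.inr ⟨hsb, hsK⟩)
  · exact Or.inl (Or.inl ⟨hsa, hsF⟩)

theorem orth_treeIdealX {n : ℕ} (X : Set (ℕ → Fin n)) {i j : Fin n} (hij : i ≠ j) :
    Orth (treeIdealX X i) (treeIdealX X j) := by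
  refine Orth.genIdeal ?_
  rintro _ ⟨x, -, rfl⟩ _ ⟨y, -, rfl⟩
  exact (sideSet_inter_subsingleton x y hij).finite

theorem Set.Finite.exists_length_lt {α : Type*} {S : Set (List α)} (hS : S.Finite) :
    ∃ N, ∀ s ∈ S, s.length < N := by
  obtain ⟨N, hN⟩ := (hS.image List.length).bddAbove
  exact ⟨N + 1, fun s hs => Nat.lt_succ_of_le (hN ⟨s, hs, rfl⟩)⟩

/-- Orthogonal ideals that are not weakly countably separated form a gap. -/
theorem isGap_of_not_weaklyCS {E : Type*} {n : ℕ} {I : Fin n → Set (Set E)}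
    (horth : ∀ i j, i ≠ j → Orth (I i) (I j)) (hI : ¬ WeaklyCS I) : IsGap I := by
  refine ⟨fun i _ j _ hij => horth i j hij, fun c hc hfin => hI ⟨fun i _ => c i, fun _ => ?_, ?_⟩⟩
  · simpa using hfin
  · exact fun x hx => ⟨0, fun i => hc i (Set.mem_univ i) _ (hx i)⟩

theorem not_weaklyCS_treeIdealX {n : ℕ} (hn : 2 ≤ n) {lam : Cardinal}
    (hreg : lam.IsRegular) (hunc : Cardinal.aleph0 < lam)
    {X : Set (ℕ → Fin n)} (hcard : lam ≤ Cardinal.mk ↥X) (hA : PropertyA lam X) :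
    ¬ WeaklyCS (treeIdealX X) := by
  rintro ⟨c, hcfin, hc⟩
  have key : ∀ x : X, ∃ k N : ℕ, (∀ s ∈ ⋂ i, c i k, s.length < N) ∧
      ∀ i, ∀ s ∈ sideSet x.1 i \ c i k, s.length < N := by
    intro x
    obtain ⟨k, hk⟩ := hc (sideSet x.1) fun i => mem_genIdeal_of_mem ⟨x.1, x.2, rfl⟩
    obtain ⟨N, hN⟩ := ((hcfin k).union (Set.finite_iUnion hk)).exists_length_lt
    exact ⟨k, N, fun s hs => hN s (Or.inl hs),
      fun i s hs => hN s (Or.inr (Set.mem_iUnion.2 ⟨i, hs⟩))⟩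
  choose k N hinter hside using key
  let f : X → ℕ × ℕ × List (Fin n) := fun x => (k x, N x, (List.range (N x)).map x.1)
  obtain ⟨⟨k₀, N₀, r⟩, hfib⟩ := Cardinal.infinite_pigeonhole_card f lam hcard hunc.le
    (by rw [hreg.cof_ord]; exact Cardinal.mk_le_aleph0.trans_lt hunc)
  obtain ⟨Z, hZ, hZcard⟩ := Cardinal.le_mk_iff_exists_subset.1 hfib
  obtain ⟨t, y, hyZ, hyt⟩ := hA (Subtype.val '' Z) (by rintro _ ⟨x, -, rfl⟩; exact x.2)
    (by rw [Cardinal.mk_image_eq Subtype.val_injective, hZcard])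
  choose x hxZ hxy using hyZ
  have hfx : ∀ i, f (x i) = (k₀, N₀, r) := fun i => hZ (hxZ i)
  have hk : ∀ i, k (x i) = k₀ := fun i => congrArg Prod.fst (hfx i)
  have hN : ∀ i, N (x i) = N₀ := fun i => congrArg (fun p => p.2.1) (hfx i)
  have hr : ∀ i, (List.range N₀).map (y i) = r := fun i => by
    rw [← hN i, ← hxy i]
    exact congrArg (fun p => p.2.2) (hfx i)
  have hlen : N₀ ≤ t.length := by
    by_contra! hlt
    let i₀ : Fin n := ⟨0, by omega⟩
    let i₁ : Fin n := ⟨1, by omega⟩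
    have heq : y i₀ t.length = y i₁ t.length :=
      List.map_inj_left.1 ((hr i₀).trans (hr i₁).symm) _ (List.mem_range.2 hlt)
    rw [(IsInitSeg.append_singleton_iff.1 (hyt i₀)).2,
      (IsInitSeg.append_singleton_iff.1 (hyt i₁)).2] at heq
    simp [i₀, i₁] at heq
  have hmem : t ∈ ⋂ i, c i k₀ := by
    refine Set.mem_iInter.2 fun i => by_contra fun hti => ?_
    have hlt := hside (x i) i t ⟨by rw [hxy i]; exact hyt i, by rwa [hk i]⟩
    rw [hN i] at hlt
    omega
  have hlt := hinter (x ⟨0, by omega⟩) t (by rwa [hk])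
  rw [hN] at hlt
  omega

/-- If `λ` is a regular uncountable cardinal and `X ⊆ n^ω` has cardinality at least `λ`
and property `A(λ,n)`, then the ideals `{J_i^X : i < n}` form an `n`-gap which is not
weakly countably separated. -/
theorem propertyA_gap (n : ℕ) (hn : 2 ≤ n) (lam : Cardinal)
    (hreg : lam.IsRegular) (hunc : Cardinal.aleph0 < lam)
    (X : Set (ℕ → Fin n)) (hcard : lam ≤ Cardinal.mk ↥X)
    (hA : PropertyA lam X) :
    IsGap (treeIdealX X) ∧ ¬ WeaklyCS (treeIdealX X) := by
  have hsep := not_weaklyCS_treeIdealX hn hreg hunc hcard hA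
  exact ⟨isGap_of_not_weaklyCS (fun _ _ hij => orth_treeIdealX X hij) hsep, hsep⟩
end
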